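/- A set E of permutations is definable both by an L2-sentence (i.e., there is an L2-sentence φ₂ with, for every n and permutation σ of {1,…,n}, M_σ ⊨ φ₂ if and only if σ ∈ E) and by an L1-sentence (i.e., there is an L1-sentence φ₁ with N_σ ⊨ φ₁ if and only if σ ∈ E) if and only if E belongs to the smallest collection of sets of permutations that contains C_λ and D_λ for every partition λ and is closed under complements (within the set of all permutations of all finite sizes), finite unions and finite intersections. -/

import Mathlib

open FirstOrder

/-- Relation symbols of the language `L2` (TOTO): two binary relation symbols `<P` and `<V`. -/
inductive TwoOrderRel : ℕ → Type
  | ltP : TwoOrderRel 2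
  | ltV : TwoOrderRel 2

/-- The first-order language `L2` with exactly two binary relation symbols `<P` and `<V`. -/
def L2 : FirstOrder.Language := ⟨fun _ => Empty, TwoOrderRel⟩

/-- The `L2`-structure `M_σ` associated to a permutation `σ` of `{1,…,n}`:
the domain is `Fin n`, `i <P j` is interpreted as `i < j`, and `i <V j` as `σ i < σ j`. -/
def permStruc2 {n : ℕ} (σ : Equiv.Perm (Fin n)) : L2.Structure (Fin n) where
  funMap := fun {_} f _ => Empty.elim f
  RelMap
    | .ltP => fun x => x 0 < x 1
    | .ltV => fun x => σ (x 0) < σ (x 1)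

/-- Satisfaction of an `L2`-sentence in the structure `M_σ`. -/
def Sat2 {n : ℕ} (σ : Equiv.Perm (Fin n)) (φ : L2.Sentence) : Prop :=
  letI := permStruc2 σ
  (Fin n) ⊨ φ

/-- Realization in `M_σ` of an `L2`-formula with free variables indexed by `α`,
under the assignment `v`. -/
def Real2 {n : ℕ} {α : Type} (σ : Equiv.Perm (Fin n)) (φ : L2.Formula α)
    (v : α → Fin n) : Prop :=
  letI := permStruc2 σ
  φ.Realize v

/-- Relation symbols of the language `L1` (TOOB): one binary relation symbol `R`. -/
inductive OneBijRel : ℕ → Type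
  | R : OneBijRel 2

/-- The first-order language `L1` with exactly one binary relation symbol `R`. -/
def L1 : FirstOrder.Language := ⟨fun _ => Empty, OneBijRel⟩

/-- The `L1`-structure `N_σ` associated to a permutation `σ` of `{1,…,n}`:
the domain is `Fin n` and `i R j` is interpreted as `σ i = j`. -/
def permStruc1 {n : ℕ} (σ : Equiv.Perm (Fin n)) : L1.Structure (Fin n) where
  funMap := fun {_} f _ => Empty.elim f
  RelMap
    | .R => fun x => σ (x 0) = x 1

/-- Satisfaction of an `L1`-sentence in the structure `N_σ`. -/
def Sat1 {n : ℕ} (σ : Equiv.Perm (Fin n)) (φ : L1.Sentence) : Prop :=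
  letI := permStruc1 σ
  (Fin n) ⊨ φ

/-- The type of all permutations of all finite sizes. -/
def Perms := Σ n : ℕ, Equiv.Perm (Fin n)

/-- A set of permutations is TOTO-definable if some `L2`-sentence defines it. -/
def TOTODef (E : Set Perms) : Prop :=
  ∃ φ : L2.Sentence, ∀ (n : ℕ) (σ : Equiv.Perm (Fin n)), Sat2 σ φ ↔ (⟨n, σ⟩ : Perms) ∈ E

/-- A set of permutations is TOOB-definable if some `L1`-sentence defines it. -/
def TOOBDef (E : Set Perms) : Prop :=
  ∃ φ : L1.Sentence, ∀ (n : ℕ) (σ : Equiv.Perm (Fin n)), Sat1 σ φ ↔ (⟨n, σ⟩ : Perms) ∈ E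

/-- The cycle type of a permutation, with fixed points counted as cycles of length 1
(a partition of `n`, as a multiset). -/
def fullCycleType {n : ℕ} (σ : Equiv.Perm (Fin n)) : Multiset ℕ :=
  σ.cycleType + Multiset.replicate (n - σ.support.card) 1

/-- The smallest collection of sets of permutations containing all `C_λ` and `D_λ`
(for partitions `λ`, i.e. finite multisets of positive integers) and closed under
complements, finite unions and finite intersections. -/
inductive CycleBool : Set Perms → Prop
  | base_C (lam : Multiset ℕ) (hlam : ∀ i ∈ lam, 0 < i) :
      CycleBool {p : Perms | fullCycleType p.2 = lam}
  | base_D (lam : Multiset ℕ) (hlam : ∀ i ∈ lam, 0 < i) :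
      CycleBool {p : Perms |
        ∃ k : ℕ, fullCycleType p.2 = lam + Multiset.replicate k 1}
  | compl {s : Set Perms} : CycleBool s → CycleBool sᶜ
  | union {s t : Set Perms} : CycleBool s → CycleBool t → CycleBool (s ∪ t)
  | inter {s t : Set Perms} : CycleBool s → CycleBool t → CycleBool (s ∩ t)


open FirstOrder.Language in
theorem sat1_conj {n : ℕ} (σ τ c : Equiv.Perm (Fin n)) (h : c * σ * c⁻¹ = τ) (φ : L1.Sentence) :
    Sat1 σ φ ↔ Sat1 τ φ := by
  have hc : ∀ x, τ (c x) = c (σ x) := by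
    intro x; rw [← h]; simp
  have key : ∀ {k : ℕ} (ψ : L1.BoundedFormula Empty k) (v w : Empty → Fin n) (xs : Fin k → Fin n),
      (@BoundedFormula.Realize L1 (Fin n) (permStruc1 σ) _ _ ψ v xs ↔
        @BoundedFormula.Realize L1 (Fin n) (permStruc1 τ) _ _ ψ w (fun i => c (xs i))) := by
    intro k ψ
    induction ψ with
    | falsum => intros; exact Iff.rfl
    | equal t₁ t₂ =>
      intro v w xs
      rcases t₁ with (⟨⟨⟩⟩ | i) | f
      · rcases t₂ with (⟨⟨⟩⟩ | j) | f
        · simp [BoundedFormula.Realize]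
        · cases f
      · cases f
    | rel R ts =>
      intro v w xs
      cases R
      have : ∀ i, ∃ j, ts i = Term.var (Sum.inr j) := by
        intro i
        rcases ts i with (⟨⟨⟩⟩ | j) | f
        · exact ⟨j, rfl⟩
        · cases f
      obtain ⟨i, hi⟩ := this 0
      obtain ⟨j, hj⟩ := this 1
      show σ _ = _ ↔ τ _ = _
      simp only [hi, hj, Term.realize, Sum.elim_inr, hc]
      simp
    | imp f g ihf ihg =>
      intro v w xs
      simp only [BoundedFormula.Realize]
      rw [ihf v w xs, ihg v w xs]
    | all f ih =>
      intro v w xs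
      simp only [BoundedFormula.Realize]
      constructor
      · intro h a
        have := (ih v w _).1 (h (c⁻¹ a))
        convert this using 1
        funext i
        refine Fin.lastCases ?_ (fun i => ?_) i <;> simp
      · intro h a
        refine (ih v w _).2 ?_
        convert h (c a) using 1
        funext i
        refine Fin.lastCases ?_ (fun i => ?_) i <;> simp
  have := key φ default default default
  unfold Sat1
  simp only [Sentence.Realize, Formula.Realize]
  convert this using 2

/-- Back-and-forth systems between `M_σ` and `M_τ`. -/
structure BF {n m : ℕ} (σ : Equiv.Perm (Fin n)) (τ : Equiv.Perm (Fin m))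
    (B : ℕ → Set (Fin n × Fin m) → Prop) : Prop where
  mono : ∀ q q' S, q' ≤ q → B q S → B q' S
  forth : ∀ q S, B (q+1) S → ∀ a, ∃ b, B q (insert (a, b) S)
  back : ∀ q S, B (q+1) S → ∀ b, ∃ a, B q (insert (a, b) S)
  eq : ∀ q S, B q S → ∀ x ∈ S, ∀ y ∈ S, (x.1 = y.1 ↔ x.2 = y.2)
  ltP : ∀ q S, B q S → ∀ x ∈ S, ∀ y ∈ S, (x.1 < y.1 ↔ x.2 < y.2)
  ltV : ∀ q S, B q S → ∀ x ∈ S, ∀ y ∈ S, (σ x.1 < σ y.1 ↔ τ x.2 < τ y.2)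

open FirstOrder.Language in
theorem bf_key {k : ℕ} (ψ : L2.BoundedFormula Empty k) :
    ∃ q : ℕ, ∀ (n m : ℕ) (σ : Equiv.Perm (Fin n)) (τ : Equiv.Perm (Fin m))
      (B : ℕ → Set (Fin n × Fin m) → Prop), BF σ τ B → ∀ S, B q S →
      ∀ (v : Empty → Fin n) (w : Empty → Fin m) (xs : Fin k → Fin n) (ys : Fin k → Fin m),
      (∀ i, (xs i, ys i) ∈ S) →
      (@BoundedFormula.Realize L2 (Fin n) (permStruc2 σ) _ _ ψ v xs ↔
        @BoundedFormula.Realize L2 (Fin m) (permStruc2 τ) _ _ ψ w ys) := by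
  induction ψ with
  | falsum => exact ⟨0, fun _ _ _ _ _ _ _ _ _ _ _ _ _ => Iff.rfl⟩
  | equal t₁ t₂ =>
    refine ⟨0, fun n m σ τ B hB S hS v w xs ys hx => ?_⟩
    rcases t₁ with (⟨⟨⟩⟩ | i) | f
    · rcases t₂ with (⟨⟨⟩⟩ | j) | f
      · simpa [BoundedFormula.Realize] using hB.eq _ _ hS _ (hx i) _ (hx j)
      · cases f
    · cases f
  | rel R ts =>
    refine ⟨0, fun n m σ τ B hB S hS v w xs ys hx => ?_⟩
    have : ∀ i, ∃ j, ts i = Term.var (Sum.inr j) := by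
      intro i
      rcases ts i with (⟨⟨⟩⟩ | j) | f
      · exact ⟨j, rfl⟩
      · cases f
    cases R with
    | ltP =>
      obtain ⟨i, hi⟩ := this 0
      obtain ⟨j, hj⟩ := this 1
      show _ < _ ↔ _ < _
      simp only [hi, hj, Term.realize, Sum.elim_inr]
      exact hB.ltP _ _ hS _ (hx i) _ (hx j)
    | ltV =>
      obtain ⟨i, hi⟩ := this 0
      obtain ⟨j, hj⟩ := this 1
      show σ _ < σ _ ↔ τ _ < τ _
      simp only [hi, hj, Term.realize, Sum.elim_inr]
      exact hB.ltV _ _ hS _ (hx i) _ (hx j)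
  | imp f g ihf ihg =>
    obtain ⟨q1, h1⟩ := ihf
    obtain ⟨q2, h2⟩ := ihg
    refine ⟨max q1 q2, fun n m σ τ B hB S hS v w xs ys hx => ?_⟩
    simp only [BoundedFormula.Realize]
    rw [h1 n m σ τ B hB S (hB.mono _ _ _ (le_max_left _ _) hS) v w xs ys hx,
      h2 n m σ τ B hB S (hB.mono _ _ _ (le_max_right _ _) hS) v w xs ys hx]
  | all f ih =>
    obtain ⟨q, hq⟩ := ih
    refine ⟨q+1, fun n m σ τ B hB S hS v w xs ys hx => ?_⟩
    simp only [BoundedFormula.Realize]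
    have hsn : ∀ a b i, ((Fin.snoc xs a : Fin _ → Fin n) i, (Fin.snoc ys b : Fin _ → Fin m) i)
        ∈ insert (a, b) S := by
      intro a b i
      refine Fin.lastCases ?_ (fun i => ?_) i
      · simp
      · simp only [Fin.snoc_castSucc]
        exact Set.mem_insert_of_mem _ (hx i)
    constructor
    · intro h b
      obtain ⟨a, ha⟩ := hB.back _ _ hS b
      exact (hq n m σ τ B hB _ ha v w _ _ (hsn a b)).1 (h a)
    · intro h a
      obtain ⟨b, hb⟩ := hB.forth _ _ hS a
      exact (hq n m σ τ B hB _ hb v w _ _ (hsn a b)).2 (h b)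

open FirstOrder.Language in
theorem bf_sat (φ : L2.Sentence) :
    ∃ q : ℕ, ∀ (n m : ℕ) (σ : Equiv.Perm (Fin n)) (τ : Equiv.Perm (Fin m))
      (B : ℕ → Set (Fin n × Fin m) → Prop), BF σ τ B → B q ∅ → (Sat2 σ φ ↔ Sat2 τ φ) := by
  obtain ⟨q, hq⟩ := bf_key φ
  refine ⟨q, fun n m σ τ B hB h0 => ?_⟩
  have := hq n m σ τ B hB ∅ h0 (fun e => e.elim) (fun e => e.elim) (fun i => i.elim0)
    (fun i => i.elim0) (fun i => i.elim0)
  unfold Sat2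
  simp only [Sentence.Realize, Formula.Realize]
  convert this using 2

/-- Truncated distance preservation. -/
def Lin (q : ℕ) (T : Set (ℕ × ℕ)) : Prop :=
  ∀ p ∈ T, ∀ p' ∈ T, min (p'.1 - p.1) (2^q) = min (p'.2 - p.2) (2^q)

theorem Lin.swap {q : ℕ} {T : Set (ℕ × ℕ)} (h : Lin q T) : Lin q (Prod.swap '' T) := by
  rintro _ ⟨p, hp, rfl⟩ _ ⟨p', hp', rfl⟩
  exact (h p hp p' hp').symm

theorem Lin.mono {q q' : ℕ} {T : Set (ℕ × ℕ)} (h : Lin q T) (hq : q' ≤ q) : Lin q' T := by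
  intro p hp p' hp'
  have := h p hp p' hp'
  have h2 : 2^q' ≤ 2^q := Nat.pow_le_pow_right (by norm_num) hq
  omega

theorem Lin.subset {q : ℕ} {T T' : Set (ℕ × ℕ)} (h : Lin q T) (hq : T' ⊆ T) : Lin q T' :=
  fun p hp p' hp' => h p (hq hp) p' (hq hp')

theorem Lin.forth {q a a' : ℕ} {T : Set (ℕ × ℕ)} (h : Lin (q+1) T) (h0 : (0, 0) ∈ T)
    (ha : (a+1, a'+1) ∈ T) (x : ℕ) (hx : x ≤ a + 1) : ∃ y, Lin q (insert (x, y) T) := by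
  classical
  obtain ⟨l, ⟨hl, hlx⟩, hlm⟩ : ∃ l, (l ∈ T ∧ l.1 ≤ x) ∧ ∀ p ∈ T, p.1 ≤ x → p.1 ≤ l.1 := by
    have hex : ∃ d, ∃ l ∈ T, l.1 + d = x := ⟨x, _, h0, by simp⟩
    obtain ⟨l, hl, hd⟩ := Nat.find_spec hex
    refine ⟨l, ⟨hl, by omega⟩, fun p hp hpx => ?_⟩
    have := Nat.find_min' hex ⟨p, hp, (by omega : p.1 + (x - p.1) = x)⟩
    omega
  obtain ⟨u, ⟨hu, hux⟩, hum⟩ : ∃ u, (u ∈ T ∧ x ≤ u.1) ∧ ∀ p ∈ T, x ≤ p.1 → u.1 ≤ p.1 := by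
    have hex : ∃ d, ∃ l ∈ T, l.1 = x + d := ⟨a + 1 - x, _, ha, by simp; omega⟩
    obtain ⟨l, hl, hd⟩ := Nat.find_spec hex
    refine ⟨l, ⟨hl, by omega⟩, fun p hp hpx => ?_⟩
    have := Nat.find_min' hex ⟨p, hp, (by omega : p.1 = x + (p.1 - x))⟩
    omega
  have hN : 1 ≤ 2^q := Nat.one_le_two_pow
  have hN2 : 2^(q+1) = 2 * 2^q := by ring
  have hlu := h l hl u hu
  have key0 : ∃ y, l.2 ≤ y ∧ y ≤ u.2 ∧ min (x - l.1) (2^q) = min (y - l.2) (2^q) ∧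
      min (u.1 - x) (2^q) = min (u.2 - y) (2^q) := by
    have hul := h u hu l hl
    rw [hN2] at hlu hul
    clear hlm hum h
    generalize 2^q = N at *
    by_cases c1 : x - l.1 < N
    · refine ⟨l.2 + (x - l.1), ?_, ?_, ?_, ?_⟩ <;> omega
    · by_cases c2 : u.1 - x < N
      · refine ⟨u.2 - (u.1 - x), ?_, ?_, ?_, ?_⟩ <;> omega
      · refine ⟨l.2 + N, ?_, ?_, ?_, ?_⟩ <;> omega
  have key : ∃ y, ∀ p ∈ T, min (p.1 - x) (2^q) = min (p.2 - y) (2^q) ∧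
      min (x - p.1) (2^q) = min (y - p.2) (2^q) := by
    obtain ⟨y, y1, y2, y3, y4⟩ := key0
    refine ⟨y, fun p hp => ?_⟩
    rcases le_total p.1 x with hpx | hpx
    · have h1 := h p hp l hl
      have h2 := h l hl p hp
      have h5 := hlm p hp hpx
      rw [hN2] at h1 h2
      clear hlm hum h hlu y4
      generalize 2^q = N at *
      constructor <;> omega
    · have h3 := h p hp u hu
      have h4 := h u hu p hp
      have h6 := hum p hp hpx
      rw [hN2] at h3 h4
      clear hlm hum h hlu y3
      generalize 2^q = N at *
      constructor <;> omega
  obtain ⟨y, hy⟩ := key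
  refine ⟨y, ?_⟩
  rintro p (rfl | hp) p' (rfl | hp')
  · simp
  · exact (hy _ hp').1
  · exact (hy _ hp).2
  · have := h p hp p' hp'
    rw [hN2] at this
    omega

theorem Lin.back {q a a' : ℕ} {T : Set (ℕ × ℕ)} (h : Lin (q+1) T) (h0 : (0, 0) ∈ T)
    (ha : (a+1, a'+1) ∈ T) (y : ℕ) (hx : y ≤ a' + 1) : ∃ x, Lin q (insert (x, y) T) := by
  obtain ⟨x, hx⟩ := h.swap.forth (a := a') (a' := a) ⟨_, h0, rfl⟩ ⟨_, ha, rfl⟩ y hx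
  refine ⟨x, hx.swap.subset ?_⟩
  rintro p (rfl | hp)
  · exact ⟨(y, x), by simp⟩
  · exact ⟨p.swap, Or.inr ⟨p, hp, rfl⟩, by simp⟩

/-- A decomposition of `σ` into increasing blocks. -/
structure Blk {n : ℕ} (σ : Equiv.Perm (Fin n)) (β r : Fin n → ℕ) (sz : ℕ → ℕ)
    (V0 : ℕ → ℕ → Prop) : Prop where
  r1 : ∀ x, 1 ≤ r x
  r2 : ∀ x, r x ≤ sz (β x)
  surj : ∀ i t, 1 ≤ t → t ≤ sz i → ∃ x, β x = i ∧ r x = t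
  sP : ∀ x y, β x = β y → (x < y ↔ r x < r y)
  sV : ∀ x y, β x = β y → (σ x < σ y ↔ r x < r y)
  dP : ∀ x y, β x ≠ β y → (x < y ↔ β x < β y)
  dV : ∀ x y, β x ≠ β y → (σ x < σ y ↔ V0 (β x) (β y))

/-- Projection of a set of pairs on block `i`. -/
def blkT {n n' : ℕ} (β r : Fin n → ℕ) (sz : ℕ → ℕ) (r' : Fin n' → ℕ) (sz' : ℕ → ℕ) (i : ℕ)
    (S : Set (Fin n × Fin n')) : Set (ℕ × ℕ) :=
  {z | z = (0, 0) ∨ z = (sz i + 1, sz' i + 1) ∨ ∃ p ∈ S, β p.1 = i ∧ z = (r p.1, r' p.2)}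

theorem blk_bf {n n' : ℕ} {σ : Equiv.Perm (Fin n)} {σ' : Equiv.Perm (Fin n')}
    {β r : Fin n → ℕ} {sz : ℕ → ℕ} {β' r' : Fin n' → ℕ} {sz' : ℕ → ℕ} {V0 : ℕ → ℕ → Prop}
    (h : Blk σ β r sz V0) (h' : Blk σ' β' r' sz' V0) :
    BF σ σ' (fun q S => (∀ p ∈ S, β p.1 = β' p.2) ∧ ∀ i, Lin q (blkT β r sz r' sz' i S)) := by
  have hlt : ∀ q S, ((∀ p ∈ S, β p.1 = β' p.2) ∧ ∀ i, Lin q (blkT β r sz r' sz' i S)) →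
      ∀ x ∈ S, ∀ y ∈ S, β x.1 = β y.1 → (r x.1 < r y.1 ↔ r' x.2 < r' y.2) := by
    rintro q S ⟨h1, h2⟩ x hx y hy hxy
    have := h2 (β x.1) (r x.1, r' x.2) (Or.inr (Or.inr ⟨x, hx, rfl, rfl⟩))
      (r y.1, r' y.2) (Or.inr (Or.inr ⟨y, hy, hxy.symm, rfl⟩))
    have hN : 1 ≤ 2^q := Nat.one_le_two_pow
    simp only at this
    omega
  have hltP : ∀ q S, ((∀ p ∈ S, β p.1 = β' p.2) ∧ ∀ i, Lin q (blkT β r sz r' sz' i S)) →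
      ∀ x ∈ S, ∀ y ∈ S, (x.1 < y.1 ↔ x.2 < y.2) := by
    intro q S hS x hx y hy
    by_cases hxy : β x.1 = β y.1
    · rw [h.sP _ _ hxy, h'.sP _ _ (by rw [← hS.1 x hx, ← hS.1 y hy, hxy]), hlt q S hS x hx y hy hxy]
    · rw [h.dP _ _ hxy, h'.dP _ _ (by rwa [← hS.1 x hx, ← hS.1 y hy]), hS.1 x hx, hS.1 y hy]
  refine ⟨?_, ?_, ?_, ?_, hltP, ?_⟩
  · rintro q q' S hq ⟨h1, h2⟩
    exact ⟨h1, fun i => (h2 i).mono hq⟩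
  · rintro q S ⟨h1, h2⟩ a
    have e0 : ((0, 0) : ℕ × ℕ) ∈ blkT β r sz r' sz' (β a) S := Or.inl rfl
    have e1 : (sz (β a) + 1, sz' (β a) + 1) ∈ blkT β r sz r' sz' (β a) S := Or.inr (Or.inl rfl)
    have ha1 := h.r1 a
    have ha2 := h.r2 a
    obtain ⟨y, hy⟩ := (h2 (β a)).forth e0 e1 (r a) (by omega)
    have hN : 1 ≤ 2^q := Nat.one_le_two_pow
    have hy0 := hy _ (Or.inr e0) _ (Or.inl rfl)
    have hy1 := hy _ (Or.inl rfl) _ (Or.inr e1)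
    simp only at hy0 hy1
    obtain ⟨b, hb, hb'⟩ := h'.surj (β a) y (by omega) (by omega)
    refine ⟨b, ?_, fun i => ?_⟩
    · rintro p (rfl | hp)
      · exact hb.symm
      · exact h1 p hp
    · by_cases hi : β a = i
      · subst hi
        refine hy.subset ?_
        rintro z (rfl | rfl | ⟨p, rfl | hp, hpi, rfl⟩)
        · exact Or.inr e0
        · exact Or.inr e1
        · left; simp [hb']
        · right; exact Or.inr (Or.inr ⟨p, hp, hpi, rfl⟩)
      · refine ((h2 i).mono (Nat.le_succ q)).subset ?_
        rintro z (rfl | rfl | ⟨p, rfl | hp, hpi, rfl⟩)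
        · exact Or.inl rfl
        · exact Or.inr (Or.inl rfl)
        · exact absurd hpi hi
        · exact Or.inr (Or.inr ⟨p, hp, hpi, rfl⟩)
  · rintro q S ⟨h1, h2⟩ b
    have e0 : ((0, 0) : ℕ × ℕ) ∈ blkT β r sz r' sz' (β' b) S := Or.inl rfl
    have e1 : (sz (β' b) + 1, sz' (β' b) + 1) ∈ blkT β r sz r' sz' (β' b) S := Or.inr (Or.inl rfl)
    have ha1 := h'.r1 b
    have ha2 := h'.r2 b
    obtain ⟨x, hx⟩ := (h2 (β' b)).back e0 e1 (r' b) (by omega)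
    have hN : 1 ≤ 2^q := Nat.one_le_two_pow
    have hx0 := hx _ (Or.inr e0) _ (Or.inl rfl)
    have hx1 := hx _ (Or.inl rfl) _ (Or.inr e1)
    simp only at hx0 hx1
    obtain ⟨a, hb, hb'⟩ := h.surj (β' b) x (by omega) (by omega)
    refine ⟨a, ?_, fun i => ?_⟩
    · rintro p (rfl | hp)
      · exact hb
      · exact h1 p hp
    · by_cases hi : β' b = i
      · subst hi
        refine hx.subset ?_
        rintro z (rfl | rfl | ⟨p, rfl | hp, hpi, rfl⟩)
        · exact Or.inr e0
        · exact Or.inr e1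
        · left; simp [hb']
        · right; exact Or.inr (Or.inr ⟨p, hp, hpi, rfl⟩)
      · refine ((h2 i).mono (Nat.le_succ q)).subset ?_
        rintro z (rfl | rfl | ⟨p, rfl | hp, hpi, rfl⟩)
        · exact Or.inl rfl
        · exact Or.inr (Or.inl rfl)
        · exact absurd (hb.symm.trans hpi) hi
        · exact Or.inr (Or.inr ⟨p, hp, hpi, rfl⟩)
  · intro q S hS x hx y hy
    have e1 := hltP q S hS x hx y hy
    have e2 := hltP q S hS y hy x hx
    constructor
    · intro e
      rw [e] at e1 e2
      exact le_antisymm (not_lt.1 (fun h => lt_irrefl _ (e2.2 h))) (not_lt.1 (fun h => lt_irrefl _ (e1.2 h)))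
    · intro e
      rw [e] at e1 e2
      exact le_antisymm (not_lt.1 (fun h => lt_irrefl _ (e2.1 h))) (not_lt.1 (fun h => lt_irrefl _ (e1.1 h)))
  · intro q S hS x hx y hy
    by_cases hxy : β x.1 = β y.1
    · rw [h.sV _ _ hxy, h'.sV _ _ (by rw [← hS.1 x hx, ← hS.1 y hy, hxy]), hlt q S hS x hx y hy hxy]
    · rw [h.dV _ _ hxy, h'.dV _ _ (by rwa [← hS.1 x hx, ← hS.1 y hy]), hS.1 x hx, hS.1 y hy]

theorem blk_init {q n n' : ℕ} (β r : Fin n → ℕ) (sz : ℕ → ℕ) (r' : Fin n' → ℕ) (sz' : ℕ → ℕ) (i : ℕ)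
    (hs : sz i = sz' i ∨ (2^q ≤ sz i ∧ 2^q ≤ sz' i)) : Lin q (blkT β r sz r' sz' i ∅) := by
  have : ∀ z ∈ blkT β r sz r' sz' i ∅, z = (0,0) ∨ z = (sz i + 1, sz' i + 1) := by
    rintro z (h | h | ⟨p, hp, _⟩)
    · exact Or.inl h
    · exact Or.inr h
    · exact hp.elim
  intro p hp p' hp'
  rcases this p hp with rfl | rfl <;> rcases this p' hp' with rfl | rfl <;> simp <;> omega

/-- Underlying function of the block rotation. -/
def rotv (a c b i : ℕ) : ℕ := if i < a then i + b + c else if i < a + c then i - a + b else i - a - c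

/-- The permutation `id_a ⊖ id_c ⊖ id_b`. -/
def rot (a c b : ℕ) : Equiv.Perm (Fin (a + c + b)) where
  toFun i := ⟨rotv a c b i, by have := i.2; unfold rotv; split_ifs <;> omega⟩
  invFun i := ⟨rotv b c a i, by have := i.2; unfold rotv; split_ifs <;> omega⟩
  left_inv i := by
    have := i.2; ext; simp only [rotv]; split_ifs <;> omega
  right_inv i := by
    have := i.2; ext; simp only [rotv]; split_ifs <;> omega

/-- Direct sum of permutations. -/
def dsum {m n : ℕ} (σ : Equiv.Perm (Fin m)) (τ : Equiv.Perm (Fin n)) : Equiv.Perm (Fin (m + n)) :=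
  finSumFinEquiv.permCongr (Equiv.Perm.sumCongr σ τ)

theorem dsum_left {m n : ℕ} (σ : Equiv.Perm (Fin m)) (τ : Equiv.Perm (Fin n)) (x : Fin (m+n))
    (h : x.1 < m) : (dsum σ τ x).1 = (σ ⟨x, h⟩).1 := by
  obtain ⟨y, rfl⟩ : ∃ y : Fin m, x = Fin.castAdd n y := ⟨⟨x, h⟩, rfl⟩
  simp [dsum, Equiv.permCongr_apply]

theorem dsum_right {m n : ℕ} (σ : Equiv.Perm (Fin m)) (τ : Equiv.Perm (Fin n)) (x : Fin (m+n))
    (h : m ≤ x.1) : (dsum σ τ x).1 = m + (τ ⟨x - m, by omega⟩).1 := by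
  obtain ⟨y, rfl⟩ : ∃ y : Fin n, x = Fin.natAdd m y := ⟨⟨x - m, by omega⟩, by ext; simp; omega⟩
  simp [dsum, Equiv.permCongr_apply]

theorem rot_blk {m : ℕ} (σ : Equiv.Perm (Fin m)) (a c b : ℕ) :
    Blk (dsum σ (rot a c b))
      (fun x => if x.1 < m then x.1 else if x.1 < m + a then m else if x.1 < m + a + c then m + 1
        else m + 2)
      (fun x => if x.1 < m then 1 else if x.1 < m + a then x.1 - m + 1 else
        if x.1 < m + a + c then x.1 - m - a + 1 else x.1 - m - a - c + 1)
      (fun i => if i < m then 1 else if i = m then a else if i = m + 1 then c else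
        if i = m + 2 then b else 0)
      (fun i j => if h : i < m ∧ j < m then σ ⟨i, h.1⟩ < σ ⟨j, h.2⟩ else
        (i < m ∧ m ≤ j) ∨ (m ≤ i ∧ m ≤ j ∧ j < i)) := by
  have hr : ∀ x : Fin (m + (a+c+b)), m ≤ x.1 →
      (dsum σ (rot a c b) x).1 = m + rotv a c b (x.1 - m) := fun x hx => dsum_right _ _ x hx
  have hl : ∀ x : Fin (m + (a+c+b)), ∀ h : x.1 < m,
      (dsum σ (rot a c b) x).1 < m := fun x hx => by rw [dsum_left _ _ x hx]; exact (σ _).2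
  refine ⟨?_, ?_, ?_, ?_, ?_, ?_, ?_⟩
  · intro x; split_ifs <;> omega
  · intro x
    have := x.2
    try dsimp only
    split_ifs <;> omega
  · intro i t h1 h2
    try dsimp only at *
    split_ifs at h2 with c1 c2 c3 c4
    · refine ⟨⟨i, by omega⟩, ?_⟩
      simp [c1]; omega
    · refine ⟨⟨m + t - 1, by omega⟩, ?_⟩
      try dsimp only
      split_ifs <;> omega
    · refine ⟨⟨m + a + t - 1, by omega⟩, ?_⟩
      try dsimp only
      split_ifs <;> omega
    · refine ⟨⟨m + a + c + t - 1, by omega⟩, ?_⟩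
      try dsimp only
      split_ifs <;> omega
    · omega
  · intro x y h
    rw [Fin.lt_def]
    try dsimp only at *
    have := x.2
    have := y.2
    by_cases hx : x.1 < m <;> by_cases hy : y.1 < m <;> simp only [hx, hy, if_true, if_false] at h ⊢ <;>
    (try split_ifs at *) <;> omega
  · intro x y h
    rw [Fin.lt_def]
    try dsimp only at *
    have h1 := x.2
    have h2 := y.2
    by_cases hx : x.1 < m
    · have hxy : x = y := by
        ext; simp only [hx, if_true] at h; split_ifs at h <;> omega
      subst hxy; simp
    · have hy : ¬ y.1 < m := by
        simp only [hx, if_false] at h; split_ifs at h <;> omega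
      rw [hr x (by omega), hr y (by omega)]
      simp only [hx, hy, if_false, rotv] at *
      clear hr hl
      split_ifs at * <;> omega
  · intro x y h
    rw [Fin.lt_def]
    try dsimp only at *
    have := x.2
    have := y.2
    by_cases hx : x.1 < m <;> by_cases hy : y.1 < m <;> simp only [hx, hy, if_true, if_false] at h ⊢ <;>
    (try split_ifs at *) <;> omega
  · intro x y h
    rw [Fin.lt_def]
    try dsimp only at *
    have h1 := x.2
    have h2 := y.2
    by_cases hx : x.1 < m <;> by_cases hy : y.1 < m
    · simp only [hx, hy, if_true, and_self, dif_pos]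
      rw [dsum_left _ _ x hx, dsum_left _ _ y hy, Fin.lt_def]
    · have := hl x hx
      have := hr y (by omega)
      simp only [hx, hy, if_true, if_false]
      split_ifs <;> simp <;> omega
    · have := hl y hy
      have := hr x (by omega)
      simp only [hx, hy, if_true, if_false]
      split_ifs <;> simp <;> omega
    · have key : ∀ z : Fin (m + (a+c+b)), ¬ z.1 < m → ∃ s, (if z.1 < m then z.1 else
          if z.1 < m + a then m else if z.1 < m + a + c then m + 1 else m + 2) = s ∧ m ≤ s ∧
          ((s = m ∧ z.1 < m + a ∧ rotv a c b (z.1 - m) = z.1 - m + b + c) ∨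
           (s = m + 1 ∧ m + a ≤ z.1 ∧ z.1 < m + a + c ∧ rotv a c b (z.1 - m) = z.1 - m - a + b) ∨
           (s = m + 2 ∧ m + a + c ≤ z.1 ∧ rotv a c b (z.1 - m) = z.1 - m - a - c)) := by
        intro z hz
        refine ⟨_, rfl, ?_⟩
        unfold rotv
        split_ifs <;> omega
      rw [hr x (by omega), hr y (by omega)]
      obtain ⟨s, hs, hs1, hs2⟩ := key x hx
      obtain ⟨t, ht, ht1, ht2⟩ := key y hy
      rw [hs, ht] at h
      rw [hs, ht]
      have hn : ¬ (s < m ∧ t < m) := by omega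
      rw [dif_neg hn]
      clear hr hl key hs ht
      generalize rotv a c b (x.1 - m) = X at *
      generalize rotv a c b (y.1 - m) = Y at *
      rcases hs2 with ⟨rfl, hs2⟩ | ⟨rfl, hs2⟩ | ⟨rfl, hs2⟩ <;>
      rcases ht2 with ⟨rfl, ht2⟩ | ⟨rfl, ht2⟩ | ⟨rfl, ht2⟩ <;> omega

theorem core_equiv (φ : L2.Sentence) : ∃ T : ℕ, 1 ≤ T ∧ ∀ (m : ℕ) (σ : Equiv.Perm (Fin m))
    (a b a' b' c : ℕ), (a = a' ∨ (T ≤ a ∧ T ≤ a')) → (b = b' ∨ (T ≤ b ∧ T ≤ b')) →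
    (Sat2 (dsum σ (rot a c b)) φ ↔ Sat2 (dsum σ (rot a' c b')) φ) := by
  obtain ⟨q, hq⟩ := bf_sat φ
  refine ⟨2^q, Nat.one_le_two_pow, fun m σ a b a' b' c ha hb => ?_⟩
  refine hq _ _ _ _ _ (blk_bf (rot_blk σ a c b) (rot_blk σ a' c b')) ⟨fun p hp => hp.elim, fun i => ?_⟩
  apply blk_init
  try dsimp only
  split_ifs <;> first | exact Or.inl rfl | assumption

theorem fct_sum {n : ℕ} (σ : Equiv.Perm (Fin n)) : (fullCycleType σ).sum = n := by
  have h : σ.support.card ≤ n := by simpa using σ.support.card_le_univ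
  simp only [fullCycleType, Multiset.sum_add, Equiv.Perm.sum_cycleType, Multiset.sum_replicate]
  simp; omega

theorem fct_pos {n : ℕ} (σ : Equiv.Perm (Fin n)) : ∀ i ∈ fullCycleType σ, 0 < i := by
  intro i hi
  simp only [fullCycleType, Multiset.mem_add] at hi
  rcases hi with hi | hi
  · have := Equiv.Perm.two_le_of_mem_cycleType hi; omega
  · have := Multiset.eq_of_mem_replicate hi; omega

theorem fct_filter {n : ℕ} (σ : Equiv.Perm (Fin n)) :
    (fullCycleType σ).filter (2 ≤ ·) = σ.cycleType := by
  have := Equiv.Perm.filter_parts_partition_eq_cycleType (σ := σ)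
  rw [Equiv.Perm.parts_partition] at this
  simpa [fullCycleType] using this

theorem fct_count {n : ℕ} (σ : Equiv.Perm (Fin n)) :
    (fullCycleType σ).count 1 = n - σ.support.card := by
  simp only [fullCycleType, Multiset.count_add, Multiset.count_replicate_self]
  rw [Multiset.count_eq_zero.2]
  · simp
  · intro h
    have := Equiv.Perm.two_le_of_mem_cycleType h; omega

theorem fct_conj {n : ℕ} (σ τ : Equiv.Perm (Fin n)) (h : fullCycleType σ = fullCycleType τ) :
    ∃ c : Equiv.Perm (Fin n), c * σ * c⁻¹ = τ := by
  have : IsConj σ τ := by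
    rw [Equiv.Perm.isConj_iff_cycleType_eq, ← fct_filter, ← fct_filter, h]
  exact isConj_iff.1 this

theorem filter_replicate_one (lam : Multiset ℕ) (h : ∀ i ∈ lam, 0 < i) :
    lam.filter (2 ≤ ·) + Multiset.replicate (lam.count 1) 1 = lam := by
  conv_rhs => rw [← Multiset.filter_add_not (2 ≤ ·) lam]
  congr 1
  rw [← Multiset.filter_eq']
  apply Multiset.filter_congr
  intro x hx
  have := h x hx
  omega

theorem fct_exists (lam : Multiset ℕ) (h : ∀ i ∈ lam, 0 < i) :
    ∃ σ : Equiv.Perm (Fin lam.sum), fullCycleType σ = lam := by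
  have hs := congrArg Multiset.sum (filter_replicate_one lam h)
  simp only [Multiset.sum_add, Multiset.sum_replicate] at hs
  simp only [smul_eq_mul, mul_one] at hs
  obtain ⟨σ, hσ⟩ := (Equiv.Perm.exists_with_cycleType_iff (Fin lam.sum)
    (m := lam.filter (2 ≤ ·))).2 ⟨by simp; omega, fun a ha => (Multiset.mem_filter.1 ha).2⟩
  refine ⟨σ, ?_⟩
  unfold fullCycleType
  rw [← Equiv.Perm.sum_cycleType, hσ]
  conv_rhs => rw [← filter_replicate_one lam h]
  congr 2
  omega

theorem fct_dsum {m n : ℕ} (σ : Equiv.Perm (Fin m)) (τ : Equiv.Perm (Fin n)) :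
    fullCycleType (dsum σ τ) = fullCycleType σ + fullCycleType τ := by
  let f1 : Fin m ≃ {x : Fin (m+n) // x.1 < m} :=
    ⟨fun i => ⟨Fin.castAdd n i, i.2⟩, fun x => ⟨x.1.1, x.2⟩, fun i => rfl, fun x => rfl⟩
  let f2 : Fin n ≃ {x : Fin (m+n) // m ≤ x.1} :=
    ⟨fun i => ⟨Fin.natAdd m i, by simp⟩, fun x => ⟨x.1.1 - m, by have := x.2; have := x.1.2; omega⟩,
      fun i => by ext; simp, fun x => by have := x.2; ext; simp; omega⟩
  have h1l : ∀ (x : Fin (m+n)) (h : x.1 < m),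
      (σ.extendDomain f1 x).1 = (σ ⟨x, h⟩).1 := by
    intro x h
    rw [Equiv.Perm.extendDomain_apply_subtype _ _ (b := x) h]; rfl
  have h1r : ∀ (x : Fin (m+n)) (h : m ≤ x.1), σ.extendDomain f1 x = x := by
    intro x h
    rw [Equiv.Perm.extendDomain_apply_not_subtype]; omega
  have h2r : ∀ (x : Fin (m+n)) (h : m ≤ x.1),
      (τ.extendDomain f2 x).1 = m + (τ ⟨x - m, by omega⟩).1 := by
    intro x h
    rw [Equiv.Perm.extendDomain_apply_subtype _ _ (b := x) h]; rfl
  have h2l : ∀ (x : Fin (m+n)) (h : x.1 < m), τ.extendDomain f2 x = x := by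
    intro x h
    rw [Equiv.Perm.extendDomain_apply_not_subtype]; omega
  have hd : Equiv.Perm.Disjoint (σ.extendDomain f1) (τ.extendDomain f2) := by
    intro x
    rcases lt_or_ge x.1 m with h | h
    · exact Or.inr (h2l x h)
    · exact Or.inl (h1r x h)
  have he : dsum σ τ = σ.extendDomain f1 * τ.extendDomain f2 := by
    ext x
    rw [Equiv.Perm.mul_apply]
    rcases lt_or_ge x.1 m with h | h
    · rw [h2l x h, h1l x h, dsum_left _ _ x h]
    · rw [h1r _ (by rw [h2r x h]; omega), h2r x h, dsum_right _ _ x h]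
  have hc : (dsum σ τ).cycleType = σ.cycleType + τ.cycleType := by
    rw [he, hd.cycleType_mul, Equiv.Perm.cycleType_extendDomain, Equiv.Perm.cycleType_extendDomain]
  unfold fullCycleType
  have h1 : σ.support.card ≤ m := by simpa using σ.support.card_le_univ
  have h2 : τ.support.card ≤ n := by simpa using τ.support.card_le_univ
  rw [← Equiv.Perm.sum_cycleType, hc, Multiset.sum_add, Equiv.Perm.sum_cycleType,
    Equiv.Perm.sum_cycleType,
    show m + n - (σ.support.card + τ.support.card) = (m - σ.support.card) + (n - τ.support.card) by
      omega, Multiset.replicate_add]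
  abel

theorem fct_regular {n d : ℕ} (σ : Equiv.Perm (Fin n)) (hd : 1 ≤ d)
    (h : ∀ x j, (σ ^ j) x = x ↔ d ∣ j) : fullCycleType σ = Multiset.replicate (n / d) d := by
  have hall : ∀ i ∈ fullCycleType σ, i = d := by
    intro i hi
    simp only [fullCycleType, Multiset.mem_add] at hi
    rcases hi with hi | hi
    · rw [Equiv.Perm.cycleType_def] at hi
      simp only [Multiset.mem_map, Function.comp] at hi
      obtain ⟨c, hc, rfl⟩ := hi
      rw [Finset.mem_val] at hc
      have hc' := Equiv.Perm.mem_cycleFactorsFinset_iff.1 hc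
      have hcy := hc'.1
      obtain ⟨x, hx⟩ := hcy.nonempty_support
      have hpow : ∀ j, (c ^ j) x = (σ ^ j) x := by
        intro j
        have := Equiv.Perm.cycle_is_cycleOf hx hc
        rw [this, Equiv.Perm.cycleOf_pow_apply_self]
      have key : ∀ j, orderOf c ∣ j ↔ d ∣ j := by
        intro j
        rw [orderOf_dvd_iff_pow_eq_one, ← h x j, ← hpow,
          hcy.pow_eq_one_iff' (Equiv.Perm.mem_support.1 hx)]
      rw [← hcy.orderOf]
      exact Nat.dvd_antisymm ((key d).2 dvd_rfl) ((key _).1 dvd_rfl)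
    · rw [Multiset.mem_replicate] at hi
      obtain ⟨h1, rfl⟩ := hi
      have : ∃ x, x ∉ σ.support := by
        by_contra hcon
        push Not at hcon
        rw [Finset.eq_univ_of_forall hcon] at h1
        simp at h1
      obtain ⟨x, hx⟩ := this
      have := (h x 1).1 (by simpa using hx)
      exact (Nat.dvd_one.1 this).symm
  have e := Multiset.eq_replicate_card.2 hall
  have hs := fct_sum σ
  rw [e] at hs ⊢
  simp only [Multiset.sum_replicate, smul_eq_mul] at hs
  congr 1
  conv_rhs => rw [← hs]
  rw [Nat.mul_div_cancel _ (by omega)]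

theorem rot_pow (a b : ℕ) (x : Fin (a + 0 + b)) (j : ℕ) :
    ((rot a 0 b ^ j) x).1 = (x.1 + j * b) % (a + b) := by
  induction j with
  | zero => 
    have := x.2
    simp; rw [Nat.mod_eq_of_lt (by omega)]
  | succ j ih =>
    rw [pow_succ', Equiv.Perm.mul_apply]
    show rotv a 0 b _ = _
    rw [ih, show x.1 + (j+1)*b = (x.1 + j * b) + b by ring, Nat.add_mod (x.1 + j*b) b (a+b)]
    have hlt : (x.1 + j * b) % (a+b) < a + b := Nat.mod_lt _ (by have := x.2; omega)
    generalize (x.1 + j * b) % (a+b) = y at *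
    unfold rotv
    rcases Nat.eq_zero_or_pos a with rfl | ha
    · simp; rw [Nat.mod_eq_of_lt]; omega
    rw [Nat.mod_eq_of_lt (show b < a + b by omega)]
    split_ifs with h1 h2
    · rw [Nat.mod_eq_of_lt] <;> omega
    · omega
    · rw [Nat.mod_eq_sub_mod (by omega), Nat.mod_eq_of_lt] <;> omega

theorem fct_rot (a b : ℕ) (hab : 1 ≤ a) :
    fullCycleType (rot a 0 b) = Multiset.replicate (Nat.gcd a b) ((a + b) / Nat.gcd a b) := by
  have hg : 0 < Nat.gcd a b := Nat.gcd_pos_of_pos_left _ hab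
  have hgd : Nat.gcd a b ∣ a + b := (Nat.gcd_dvd_left a b).add (Nat.gcd_dvd_right a b)
  obtain ⟨d, hd⟩ := hgd
  have hdd : (a + b) / Nat.gcd a b = d := by rw [hd]; exact Nat.mul_div_cancel_left _ hg
  have hd1 : 1 ≤ d := by
    rcases Nat.eq_zero_or_pos d with rfl | h
    · simp at hd; omega
    · exact h
  rw [hdd, fct_regular (d := d) _ hd1]
  · congr 1
    rw [show a + 0 + b = a + b by omega, hd, Nat.mul_div_cancel _ hd1]
  · intro x j
    have hx := x.2
    rw [Fin.ext_iff, rot_pow]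
    have e1 : (x.1 + j * b) % (a + b) = x.1 ↔ (a + b) ∣ j * b := by
      have hm : x.1 % (a+b) = x.1 := Nat.mod_eq_of_lt (by omega)
      constructor
      · intro h
        have : x.1 + 0 ≡ x.1 + j * b [MOD (a+b)] := by
          show _ % _ = _ % _
          rw [h, add_zero, hm]
        have := Nat.ModEq.add_left_cancel' _ this
        exact (Nat.modEq_zero_iff_dvd).1 this.symm
      · rintro ⟨k, hk⟩
        rw [hk, Nat.add_mul_mod_self_left, hm]
    rw [e1]
    obtain ⟨a', b', hco, ha', hb'⟩ := Nat.exists_coprime a b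
    generalize Nat.gcd a b = g at *
    subst ha' hb'
    have hd' : d = a' + b' := by
      have : g * d = g * (a' + b') := by rw [← hd]; ring
      exact Nat.eq_of_mul_eq_mul_left hg this
    have hco2 : Nat.Coprime d b' := by rw [hd']; simpa using hco
    rw [hd, show j * (b' * g) = g * (j * b') by ring, Nat.mul_dvd_mul_iff_left hg]
    exact ⟨fun h => hco2.dvd_of_dvd_mul_right h, fun h => h.mul_right _⟩

theorem count_rot1 (a : ℕ) : (fullCycleType (rot a 1 a)).count 1 = 1 := by
  rw [fct_count]
  have : (rot a 1 a).support = Finset.univ.erase ⟨a, by omega⟩ := by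
    ext x
    have := x.2
    simp only [Equiv.Perm.mem_support, Finset.mem_erase, Finset.mem_univ, and_true, ne_eq,
      Fin.ext_iff]
    show ¬ rotv a 1 a x = x ↔ _
    unfold rotv
    split_ifs <;> omega
  rw [this, Finset.card_erase_of_mem (Finset.mem_univ _)]
  simp; omega

theorem count_rot2 (a : ℕ) : (fullCycleType (rot (a+1) 1 a)).count 1 = 0 := by
  rw [fct_count]
  have : (rot (a+1) 1 a).support = Finset.univ := by
    ext x
    have := x.2
    simp only [Equiv.Perm.mem_support, Finset.mem_univ, ne_eq, Fin.ext_iff, iff_true]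
    show ¬ rotv (a+1) 1 a x = x
    unfold rotv
    split_ifs <;> omega
  rw [this]
  simp

/-- `E` seen as a set of cycle types. -/
def hatE (E : Set Perms) (lam : Multiset ℕ) : Prop :=
  ∃ p ∈ E, fullCycleType p.2 = lam

theorem hatE_iff (E : Set Perms) (h1 : TOOBDef E) (n : ℕ) (σ : Equiv.Perm (Fin n)) :
    hatE E (fullCycleType σ) ↔ (⟨n, σ⟩ : Perms) ∈ E := by
  obtain ⟨φ, hφ⟩ := h1
  constructor
  · rintro ⟨⟨n', τ⟩, hp, he⟩
    have hn : n' = n := by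
      rw [← fct_sum τ, ← fct_sum σ]; exact congrArg _ he
    subst hn
    obtain ⟨c, hc⟩ := fct_conj τ σ he
    exact (hφ _ _).1 ((sat1_conj τ σ c hc φ).1 ((hφ _ _).2 hp))
  · intro h
    exact ⟨_, h, rfl⟩

/-- abbreviation for multisets of positive integers -/
def PosM (G : Multiset ℕ) : Prop := ∀ i ∈ G, 0 < i

theorem PosM.add {G H : Multiset ℕ} (hG : PosM G) (hH : PosM H) : PosM (G + H) := by
  intro i hi
  rcases Multiset.mem_add.1 hi with h | h
  · exact hG i h
  · exact hH i h

theorem PosM.rep {k n : ℕ} (hk : 0 < k) : PosM (Multiset.replicate n k) := by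
  intro i hi
  rw [Multiset.eq_of_mem_replicate hi]; exact hk

theorem hat_core (E : Set Perms) (h2 : TOTODef E) (h1 : TOOBDef E) :
    ∃ T : ℕ, 1 ≤ T ∧ ∀ G : Multiset ℕ, PosM G →
    ∀ (a b a' b' c : ℕ), (a = a' ∨ (T ≤ a ∧ T ≤ a')) → (b = b' ∨ (T ≤ b ∧ T ≤ b')) →
    (hatE E (G + fullCycleType (rot a c b)) ↔ hatE E (G + fullCycleType (rot a' c b'))) := by
  obtain ⟨φ, hφ⟩ := h2
  obtain ⟨T, hT1, hT⟩ := core_equiv φ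
  refine ⟨T, hT1, fun G hG a b a' b' c ha hb => ?_⟩
  obtain ⟨σ, hσ⟩ := fct_exists G hG
  rw [← hσ, ← fct_dsum, ← fct_dsum, hatE_iff E h1, hatE_iff E h1, ← hφ, ← hφ]
  exact hT _ _ _ _ _ _ _ ha hb

theorem exists_coprime_split (T n : ℕ) (hn : 2 * T + 6 ≤ n) :
    ∃ a b, T ≤ a ∧ T ≤ b ∧ a + b = n ∧ Nat.Coprime a b := by
  obtain ⟨k, rfl | rfl⟩ : ∃ k, n = 2 * k ∨ n = 2 * k + 1 := ⟨n / 2, by omega⟩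
  · obtain ⟨j, rfl | rfl⟩ : ∃ j, k = 2 * j ∨ k = 2 * j + 1 := ⟨k / 2, by omega⟩
    · refine ⟨2 * j - 1, 2 * j + 1, by omega, by omega, by omega, ?_⟩
      rw [show 2 * j + 1 = (2 * j - 1) + 2 by omega, Nat.coprime_self_add_right,
        Nat.coprime_two_right]
      exact ⟨j - 1, by omega⟩
    · refine ⟨2 * j - 1, 2 * j + 3, by omega, by omega, by omega, ?_⟩
      rw [show 2 * j + 3 = (2 * j - 1) + 2 ^ 2 by omega, Nat.coprime_self_add_right]
      apply Nat.Coprime.pow_right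
      rw [Nat.coprime_two_right]
      exact ⟨j - 1, by omega⟩
  · exact ⟨k, k + 1, by omega, by omega, by omega, by simp⟩

/-- The equivalence property extracted from definability. -/
def Abs (E : Set Perms) (T : ℕ) : Prop := 1 ≤ T ∧ ∀ G : Multiset ℕ, PosM G →
    ∀ (a b a' b' c : ℕ), (a = a' ∨ (T ≤ a ∧ T ≤ a')) → (b = b' ∨ (T ≤ b ∧ T ≤ b')) →
    (hatE E (G + fullCycleType (rot a c b)) ↔ hatE E (G + fullCycleType (rot a' c b')))

theorem absE_rot {E : Set Perms} {T : ℕ} (hA : Abs E T) (G : Multiset ℕ) (hG : PosM G) (a b : ℕ) (ha : T ≤ a) (hb : T ≤ b) :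
    hatE E (G + Multiset.replicate (Nat.gcd a b) ((a + b) / Nat.gcd a b)) ↔
      hatE E (G + Multiset.replicate T 2) := by
  have hT1 := hA.1
  have := hA.2 G hG a b T T 0 (Or.inr ⟨ha, le_rfl⟩) (Or.inr ⟨hb, le_rfl⟩)
  rw [fct_rot _ _ (by omega), fct_rot _ _ hA.1] at this
  rw [this, Nat.gcd_self, show (T + T) / T = 2 by rw [← two_mul]; exact Nat.mul_div_cancel _ hA.1]

theorem absE_pow {E : Set Perms} {T : ℕ} (hA : Abs E T) (G : Multiset ℕ) (hG : PosM G) (k g : ℕ) (hk : 2 ≤ k) (hg : T ≤ g) :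
    hatE E (G + Multiset.replicate g k) ↔ hatE E (G + Multiset.replicate T 2) := by
  have hT1 := hA.1
  obtain ⟨k, rfl⟩ : ∃ k', k = k' + 2 := ⟨k - 2, by omega⟩
  have := absE_rot hA G hG g ((k + 1) * g) hg (by nlinarith)
  rw [← this, show Nat.gcd g ((k+1) * g) = g by simp,
    show g + (k+1) * g = (k + 2) * g by ring, Nat.mul_div_cancel _ (by omega)]

theorem absE_one {E : Set Perms} {T : ℕ} (hA : Abs E T) (G : Multiset ℕ) (hG : PosM G) (n : ℕ) (hn : 2 * T + 6 ≤ n) :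
    hatE E (G + {n}) ↔ hatE E (G + Multiset.replicate T 2) := by
  obtain ⟨a, b, ha, hb, rfl, hc⟩ := exists_coprime_split T n hn
  have := absE_rot hA G hG a b ha hb
  rw [← this, Nat.Coprime.gcd_eq_one hc]
  simp

theorem absE_mult {E : Set Perms} {T : ℕ} (hA : Abs E T) (lam : Multiset ℕ) (hl : ∀ i ∈ lam, 2 ≤ i) (G : Multiset ℕ) (hG : PosM G) :
    hatE E (G + lam + Multiset.replicate T 2) ↔ hatE E (G + Multiset.replicate T 2) := by
  induction lam using Multiset.induction_on with
  | empty => simp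
  | cons k lam ih =>
    have hk : 2 ≤ k := hl k (by simp)
    have hlam : ∀ i ∈ lam, 2 ≤ i := fun i hi => hl i (Multiset.mem_cons_of_mem hi)
    rw [← ih hlam]
    have p1 : PosM (G + lam) := hG.add (fun i hi => by have := hlam i hi; omega)
    have p2 : PosM (G + (k ::ₘ lam)) := hG.add (fun i hi => by have := hl i hi; omega)
    rw [← absE_pow hA _ p2 k T hk le_rfl, ← absE_pow hA _ p1 k (T+1) hk (by omega)]
    have : G + (k ::ₘ lam) + Multiset.replicate T k = G + lam + Multiset.replicate (T+1) k := by
      rw [Multiset.replicate_succ, Multiset.add_cons, Multiset.add_cons, Multiset.cons_add]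
    rw [this]

theorem absE_large {E : Set Perms} {T : ℕ} (hA : Abs E T) (lam : Multiset ℕ) (hl : ∀ i ∈ lam, 2 ≤ i) (G : Multiset ℕ) (hG : PosM G)
    (hs : (2 * T + 6) * (2 * T + 6) * T ≤ lam.sum) :
    hatE E (G + lam) ↔ hatE E (G + Multiset.replicate T 2) := by
  by_cases h1 : ∃ n ∈ lam, 2 * T + 6 ≤ n
  · obtain ⟨n, hn, hn2⟩ := h1
    obtain ⟨lam', rfl⟩ := Multiset.exists_cons_of_mem hn
    have hlam : ∀ i ∈ lam', 2 ≤ i := fun i hi => hl i (Multiset.mem_cons_of_mem hi)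
    rw [← absE_mult hA lam' hlam G hG, ← absE_one hA _ (hG.add (fun i hi => by have := hlam i hi; omega)) n hn2]
    rw [← Multiset.singleton_add, add_assoc, add_comm lam']
  · push Not at h1
    have h2 : ∃ k ∈ lam, T ≤ lam.count k := by
      by_contra hcon
      push Not at hcon
      have e : lam.sum = ∑ k ∈ lam.toFinset, lam.count k * k := by
        rw [Finset.sum_multiset_count]; simp
      have hle : lam.sum ≤ ∑ k ∈ lam.toFinset, T * (2 * T + 6) := by
        rw [e]
        apply Finset.sum_le_sum
        intro k hk
        rw [Multiset.mem_toFinset] at hk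
        exact Nat.mul_le_mul (hcon k hk).le (h1 k hk).le
      have hcard : lam.toFinset.card ≤ 2 * T + 5 := by
        have : lam.toFinset ⊆ Finset.Ico 1 (2 * T + 6) := by
          intro k hk
          rw [Multiset.mem_toFinset] at hk
          have := h1 k hk
          have := hl k hk
          simp; omega
        simpa using Finset.card_le_card this
      rw [Finset.sum_const, smul_eq_mul] at hle
      have : lam.toFinset.card * (T * (2*T+6)) ≤ (2*T+5) * (T * (2*T+6)) :=
        Nat.mul_le_mul_right _ hcard
      have hp : 0 < T * (2 * T + 6) := Nat.mul_pos hA.1 (by omega)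
      have e3 : (2 * T + 6) * (2 * T + 6) * T = (2*T+5) * (T * (2*T+6)) + T * (2 * T + 6) := by ring
      omega
    obtain ⟨k, hk, hkT⟩ := h2
    obtain ⟨lam', rfl⟩ := Multiset.le_iff_exists_add.1 (Multiset.le_count_iff_replicate_le.1 hkT)
    have hlam : ∀ i ∈ lam', 2 ≤ i := fun i hi => hl i (Multiset.mem_add.2 (Or.inr hi))
    rw [← absE_mult hA lam' hlam G hG,
      ← absE_pow hA _ (hG.add (fun i hi => by have := hlam i hi; omega)) k T (hl k hk) le_rfl]
    rw [add_assoc, add_comm lam']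

theorem absE_fix {E : Set Perms} {T : ℕ} (hA : Abs E T) (G : Multiset ℕ) (hG : PosM G) :
    hatE E (G + {1} + Multiset.replicate T 2) ↔ hatE E (G + Multiset.replicate T 2) := by
  set a := (2 * T + 6) * (2 * T + 6) * T with ha
  have haT : T ≤ a := Nat.le_mul_of_pos_left _ (by positivity)
  have key := hA.2 G hG a a (a+1) a 1 (Or.inr ⟨haT, by omega⟩) (Or.inl rfl)
  have e1 := filter_replicate_one _ (fct_pos (rot a 1 a))
  have e2 := filter_replicate_one _ (fct_pos (rot (a+1) 1 a))
  have s1 := fct_sum (rot a 1 a)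
  have s2 := fct_sum (rot (a+1) 1 a)
  rw [← e1, Multiset.sum_add, count_rot1] at s1
  rw [← e2, Multiset.sum_add, count_rot2] at s2
  rw [← e1, ← e2, count_rot1, count_rot2] at key
  simp only [Multiset.replicate_one, Multiset.replicate_zero, Multiset.sum_singleton,
    Multiset.sum_zero, add_zero] at key s1 s2
  have hT1 := hA.1
  have b1 : (2 * T + 6) * (2 * T + 6) * T ≤
      (Multiset.filter (fun x => 2 ≤ x) (fullCycleType (rot a 1 a))).sum := by omega
  have b2 : (2 * T + 6) * (2 * T + 6) * T ≤
      (Multiset.filter (fun x => 2 ≤ x) (fullCycleType (rot (a+1) 1 a))).sum := by omega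
  rw [add_comm (Multiset.filter _ _) {1}, ← add_assoc] at key
  rw [absE_large hA _ (fun i hi => (Multiset.mem_filter.1 hi).2) _
    (hG.add (by intro i hi; simp at hi; omega)) b1,
    absE_large hA _ (fun i hi => (Multiset.mem_filter.1 hi).2) _ hG b2] at key
  exact key

theorem absE_all {E : Set Perms} {T : ℕ} (hA : Abs E T) (lam : Multiset ℕ) (hl : PosM lam)
    (hs : (2 * T + 6) * (2 * T + 6) * T ≤ (lam.filter (2 ≤ ·)).sum) :
    hatE E lam ↔ hatE E (Multiset.replicate T 2) := by
  have e1 := filter_replicate_one _ hl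
  rw [← e1, add_comm, absE_large hA _ (fun i hi => (Multiset.mem_filter.1 hi).2) _
    (PosM.rep (by norm_num)) hs]
  generalize Multiset.count 1 lam = j
  induction j with
  | zero => simp
  | succ j ih =>
    refine Iff.trans ?_ ih
    rw [Multiset.replicate_succ, ← Multiset.singleton_add, add_comm {1}]
    exact absE_fix hA _ (PosM.rep (by norm_num))

theorem absE_ones {E : Set Perms} {T : ℕ} (hA : Abs E T) (G : Multiset ℕ) (hG : PosM G) (i j : ℕ) (hi : T ≤ i) (hj : T ≤ j) :
    hatE E (G + Multiset.replicate i 1) ↔ hatE E (G + Multiset.replicate j 1) := by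
  have hT1 := hA.1
  have := hA.2 G hG i 0 j 0 0 (Or.inr ⟨hi, hj⟩) (Or.inl rfl)
  rw [fct_rot _ _ (by omega), fct_rot _ _ (by omega)] at this
  simpa [Nat.div_self (show 0 < i by omega), Nat.div_self (show 0 < j by omega)] using this


theorem cb_empty : CycleBool ∅ := by
  have h := CycleBool.base_C 0 (by simp)
  have := h.inter h.compl
  rwa [Set.inter_compl_self] at this

theorem cb_biUnion {ι : Type*} (s : Finset ι) (f : ι → Set Perms) (h : ∀ i ∈ s, CycleBool (f i)) :
    CycleBool (⋃ i ∈ s, f i) := by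
  classical
  induction s using Finset.induction_on with
  | empty => simpa using cb_empty
  | insert a s ha ih =>
    rw [Finset.set_biUnion_insert]
    exact (h a (by simp)).union (ih fun i hi => h i (by simp [hi]))

theorem finite_parts (K : ℕ) : {m : Multiset ℕ | PosM m ∧ m.sum < K}.Finite := by
  have : {m : Multiset ℕ | PosM m ∧ m.sum < K} ⊆
      ⋃ n ∈ Finset.range K, Set.range (fun p : Nat.Partition n => p.parts) := by
    rintro m ⟨h1, h2⟩
    simp only [Set.mem_iUnion, Finset.mem_range]
    exact ⟨m.sum, h2, ⟨m, fun {i} hi => h1 i hi, rfl⟩, rfl⟩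
  refine Set.Finite.subset ?_ this
  exact Set.Finite.biUnion (Finset.finite_toSet _) (fun n _ => Set.finite_range _)

theorem cb_piece {E s : Set Perms} (hs : CycleBool s)
    (h : ∀ p ∈ s, ∀ q ∈ s, p ∈ E → q ∈ E) : CycleBool (s ∩ E) := by
  by_cases hne : ∃ p ∈ s, p ∈ E
  · obtain ⟨p, hp, hpE⟩ := hne
    rwa [Set.inter_eq_left.2 (fun q hq => h p hp q hq hpE)]
  · push Not at hne
    have h0 : s ∩ E = ∅ := Set.eq_empty_of_forall_notMem (fun q hq => hne q hq.1 hq.2)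
    rw [h0]
    exact cb_empty

theorem forward (E : Set Perms) (h2 : TOTODef E) (h1 : TOOBDef E) : CycleBool E := by
  classical
  obtain ⟨T, hA⟩ : ∃ T, Abs E T := hat_core E h2 h1
  have hE : ∀ p : Perms, p ∈ E ↔ hatE E (fullCycleType p.2) := fun p => (hatE_iff E h1 p.1 p.2).symm
  set N := (2 * T + 6) * (2 * T + 6) * T with hN
  set F := (finite_parts (N + T)).toFinset with hF
  have hFm : ∀ m, m ∈ F ↔ PosM m ∧ m.sum < N + T := by intro m; simp [hF]
  let C : Multiset ℕ → Set Perms := fun lam => {p : Perms | fullCycleType p.2 = lam}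
  let D : Multiset ℕ → Set Perms := fun lam =>
    {p : Perms | ∃ k : ℕ, fullCycleType p.2 = lam + Multiset.replicate k 1}
  let U1 : Set Perms := ⋃ i ∈ F, C i
  let U2 : Set Perms := ⋃ i ∈ F.filter (fun m => T ≤ m.count 1), D i
  have hU1 : CycleBool U1 := cb_biUnion _ _ fun i hi => CycleBool.base_C i ((hFm i).1 hi).1
  have hU2 : CycleBool U2 := cb_biUnion _ _ fun i hi =>
    CycleBool.base_D i ((hFm i).1 (Finset.mem_filter.1 hi).1).1
  have hrest : ∀ p ∈ (U1 ∪ U2)ᶜ, (p ∈ E ↔ hatE E (Multiset.replicate T 2)) := by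
    intro p hp
    rw [hE]
    apply absE_all hA _ (fct_pos _)
    by_contra hlt
    push Not at hlt
    rw [← hN] at hlt
    apply hp
    have e := filter_replicate_one _ (fct_pos p.2)
    have es := congrArg Multiset.sum e
    rw [Multiset.sum_add, Multiset.sum_replicate, smul_eq_mul, mul_one] at es
    by_cases hc : (fullCycleType p.2).count 1 < T
    · left
      simp only [U1, Set.mem_iUnion]
      exact ⟨_, (hFm _).2 ⟨fct_pos p.2, by omega⟩, rfl⟩
    · right
      simp only [U2, Set.mem_iUnion]
      push Not at hc
      refine ⟨(fullCycleType p.2).filter (2 ≤ ·) + Multiset.replicate T 1, ?_,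
        (fullCycleType p.2).count 1 - T, ?_⟩
      · rw [Finset.mem_filter, hFm]
        refine ⟨⟨PosM.add (fun i hi => ?_) (PosM.rep (by norm_num)), ?_⟩, ?_⟩
        · have := (Multiset.mem_filter.1 hi).2; omega
        · rw [Multiset.sum_add, Multiset.sum_replicate, smul_eq_mul, mul_one]; omega
        · rw [Multiset.count_add, Multiset.count_replicate_self]; omega
      · rw [add_assoc, ← Multiset.replicate_add, Nat.add_sub_cancel' hc, e]
  have hdec : E = (⋃ i ∈ F, (C i ∩ E)) ∪
      (⋃ i ∈ F.filter (fun m => T ≤ m.count 1), (D i ∩ E)) ∪ ((U1 ∪ U2)ᶜ ∩ E) := by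
    ext p
    simp only [Set.mem_union, Set.mem_inter_iff, Set.mem_compl_iff, Set.mem_iUnion, U1, U2]
    by_cases hp : p ∈ E
    · simp only [hp, and_true, true_iff]
      exact em _
    · simp [hp]
  rw [hdec]
  refine CycleBool.union (CycleBool.union ?_ ?_) ?_
  · refine cb_biUnion _ _ fun i hi => cb_piece (CycleBool.base_C i ((hFm i).1 hi).1) ?_
    intro p hp q hq hpE
    rw [hE] at hpE ⊢
    have hp' : fullCycleType p.2 = i := hp
    have hq' : fullCycleType q.2 = i := hq
    rwa [hq', ← hp']
  · refine cb_biUnion _ _ fun i hi => cb_piece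
      (CycleBool.base_D i ((hFm i).1 (Finset.mem_filter.1 hi).1).1) ?_
    rintro p ⟨k, hk⟩ q ⟨k', hk'⟩ hpE
    have hiT := (Finset.mem_filter.1 hi).2
    have hip := ((hFm i).1 (Finset.mem_filter.1 hi).1).1
    rw [hE] at hpE ⊢
    rw [hk'] ; rw [hk] at hpE
    have e := filter_replicate_one _ hip
    have e2 : ∀ k, i + Multiset.replicate k 1 =
        i.filter (2 ≤ ·) + Multiset.replicate (i.count 1 + k) 1 := by
      intro k
      rw [Multiset.replicate_add, ← add_assoc, e]
    rw [e2] at hpE ⊢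
    refine (absE_ones hA _ ?_ _ _ ?_ ?_).1 hpE
    · intro j hj
      have := (Multiset.mem_filter.1 hj).2; omega
    · omega
    · omega
  · refine cb_piece (hU1.union hU2).compl ?_
    intro p hp q hq hpE
    rw [hrest q hq]
    exact (hrest p hp).1 hpE

/-- Graph of the auxiliary permutation. -/
def Gr {m n : ℕ} (τ : Equiv.Perm (Fin m)) (x : Fin m → Fin n) (y z : Fin n) : Prop :=
  (∃ i, y = x i ∧ z = x (τ⁻¹ i)) ∨ ((∀ i, ¬ y = x i) ∧ y = z)

theorem gr_ex {m n : ℕ} (τ : Equiv.Perm (Fin m)) (x : Fin m → Fin n) (y : Fin n) :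
    ∃ z, Gr τ x y z := by
  by_cases h : ∃ i, y = x i
  · obtain ⟨i, hi⟩ := h
    exact ⟨_, Or.inl ⟨i, hi, rfl⟩⟩
  · exact ⟨y, Or.inr ⟨fun i hi => h ⟨i, hi⟩, rfl⟩⟩

theorem gr_uniq {m n : ℕ} (τ : Equiv.Perm (Fin m)) (x : Fin m → Fin n)
    (hx : Function.Injective x) (y z z' : Fin n) (h : Gr τ x y z) (h' : Gr τ x y z') : z = z' := by
  rcases h with ⟨i, h1, h2⟩ | ⟨h1, h2⟩ <;> rcases h' with ⟨j, h3, h4⟩ | ⟨h3, h4⟩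
  · have : i = j := hx (h1.symm.trans h3)
    rw [h2, h4, this]
  · exact absurd h1 (h3 i)
  · exact absurd h3 (h1 j)
  · exact h2.symm.trans h4

theorem gr_mono {m n : ℕ} (σ : Equiv.Perm (Fin n)) (τ : Equiv.Perm (Fin m)) (x : Fin m → Fin n)
    (hx : Function.Injective x) :
    (∀ y z y' z', Gr τ x y z → Gr τ x y' z' → y < y' → σ z < σ z') ↔
      ∀ y z, Gr τ x y z → σ z = y := by
  constructor
  · intro h
    choose g hg using gr_ex τ x
    have hm : StrictMono (fun y => σ (g y)) := fun a b hab => h _ _ _ _ (hg a) (hg b) hab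
    intro y z hyz
    rw [gr_uniq τ x hx y z (g y) hyz (hg y)]
    exact le_antisymm (hm.apply_le (x := y)) (hm.le_apply (x := y))
  · intro h y z y' z' h1 h2 h3
    rwa [h _ _ h1, h _ _ h2]

theorem gr_comb {m n : ℕ} (σ : Equiv.Perm (Fin n)) (τ : Equiv.Perm (Fin m)) :
    (∃ x : Fin m → Fin n, Function.Injective x ∧ ∀ y z, Gr τ x y z → σ z = y) ↔
      ∃ k, fullCycleType σ = fullCycleType τ + Multiset.replicate k 1 := by
  classical
  constructor
  · rintro ⟨x, hx, h⟩
    have hmn : m ≤ n := by simpa using Fintype.card_le_of_injective x hx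
    let f := Equiv.ofInjective x hx
    have e : σ = τ.extendDomain f := by
      ext1 w
      by_cases hw : ∃ i, w = x i
      · obtain ⟨i, rfl⟩ := hw
        have h1 : σ (x i) = x (τ i) := h _ _ (Or.inl ⟨τ i, rfl, by simp⟩)
        have h2 := Equiv.Perm.extendDomain_apply_image τ f i
        rw [h1]
        exact h2.symm
      · rw [Equiv.Perm.extendDomain_apply_not_subtype]
        · exact h _ _ (Or.inr ⟨fun i hi => hw ⟨i, hi⟩, rfl⟩)
        · rintro ⟨i, hi⟩
          exact hw ⟨i, hi.symm⟩
    refine ⟨n - m, ?_⟩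
    have h1 : σ.cycleType = τ.cycleType := by rw [e, Equiv.Perm.cycleType_extendDomain]
    have h2 : σ.support.card = τ.support.card := by
      rw [← Equiv.Perm.sum_cycleType, ← Equiv.Perm.sum_cycleType, h1]
    have h3 : τ.support.card ≤ m := by simpa using Finset.card_le_univ τ.support
    unfold fullCycleType
    rw [h1, h2, add_assoc, ← Multiset.replicate_add]
    congr 2
    omega
  · rintro ⟨k, hk⟩
    have hn : n = m + k := by
      have := congrArg Multiset.sum hk
      rw [Multiset.sum_add, fct_sum, fct_sum, Multiset.sum_replicate] at this
      simpa using this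
    subst hn
    have h1 : fullCycleType (dsum τ (1 : Equiv.Perm (Fin k))) = fullCycleType σ := by
      rw [fct_dsum, hk]
      simp [fullCycleType]
    obtain ⟨c, hc⟩ := fct_conj _ _ h1
    refine ⟨fun i => c (Fin.castAdd k i), fun i j hij => ?_, ?_⟩
    · simpa using hij
    · rintro y z (⟨i, rfl, rfl⟩ | ⟨h2, rfl⟩)
      · rw [← hc]
        have hcc : ∀ w, c⁻¹ (c w) = w := fun w => c.symm_apply_apply w
        simp only [Equiv.Perm.mul_apply, hcc]
        congr 1
        ext
        rw [dsum_left _ _ _ (by simp)]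
        simp
      · rw [← hc]
        simp only [Equiv.Perm.mul_apply]
        have h3 : m ≤ (c⁻¹ y).1 := by
          by_contra hlt
          apply h2 ⟨(c⁻¹ y).1, by omega⟩
          have : Fin.castAdd k ⟨(c⁻¹ y).1, by omega⟩ = c⁻¹ y := rfl
          change y = c (Fin.castAdd k ⟨(c⁻¹ y).1, by omega⟩)
          rw [this]; exact (c.apply_symm_apply y).symm
        have h4 : dsum τ 1 (c⁻¹ y) = c⁻¹ y := by
          ext
          rw [dsum_right _ _ _ h3]
          change m + ((c⁻¹ y).1 - m) = _
          omega
        rw [h4]; exact c.apply_symm_apply y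

section formulas
open FirstOrder.Language

/-- Formula for `Gr`. -/
noncomputable def grF (L : FirstOrder.Language.{0,0}) {m : ℕ} (τ : Equiv.Perm (Fin m)) {α : Type}
    (x : Fin m → α) (y z : α) : L.Formula α :=
  (Formula.iSup fun i : Fin m => Term.equal (Term.var y) (Term.var (x i)) ⊓
      Term.equal (Term.var z) (Term.var (x (τ⁻¹ i)))) ⊔
    ((Formula.iInf fun i : Fin m => Formula.not (Term.equal (Term.var y) (Term.var (x i)))) ⊓
      Term.equal (Term.var y) (Term.var z))

theorem grF_realize (L : FirstOrder.Language.{0,0}) {m n : ℕ} [L.Structure (Fin n)]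
    (τ : Equiv.Perm (Fin m)) {α : Type} (x : Fin m → α) (y z : α) (v : α → Fin n) :
    (grF L τ x y z).Realize v ↔ Gr τ (fun i => v (x i)) (v y) (v z) := by
  simp [grF, Gr]

/-- Injectivity formula. -/
noncomputable def injF (L : FirstOrder.Language.{0,0}) (m : ℕ) {α : Type} (x : Fin m → α) :
    L.Formula α :=
  Formula.iInf fun i : Fin m => Formula.iInf fun j : Fin m =>
    (Term.equal (Term.var (x i)) (Term.var (x j)) : L.Formula α).imp (if i = j then ⊤ else ⊥)

theorem injF_realize (L : FirstOrder.Language.{0,0}) {m n : ℕ} [L.Structure (Fin n)]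
    {α : Type} (x : Fin m → α) (v : α → Fin n) :
    (injF L m x).Realize v ↔ Function.Injective (fun i => v (x i)) := by
  simp only [injF, Formula.realize_iInf, Formula.realize_imp, Formula.realize_equal,
    Term.realize_var, Function.Injective]
  refine forall_congr' fun i => forall_congr' fun j => imp_congr_right fun _ => ?_
  split_ifs with h <;> simp [h]

/-- The defining sentence in one bijection language. -/
noncomputable def sent1 {m : ℕ} (τ : Equiv.Perm (Fin m)) : L1.Sentence :=
  Formula.iExs (Fin m) (injF L1 m (α := Empty ⊕ Fin m) Sum.inr ⊓
    Formula.iAlls (Fin 2) ((grF L1 τ (α := (Empty ⊕ Fin m) ⊕ Fin 2)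
      (fun i => Sum.inl (Sum.inr i)) (Sum.inr 0) (Sum.inr 1)).imp
      (Relations.formula₂ (L := L1) OneBijRel.R (Term.var (Sum.inr 1)) (Term.var (Sum.inr 0)))))

/-- The defining sentence in two orders language. -/
noncomputable def sent2 {m : ℕ} (τ : Equiv.Perm (Fin m)) : L2.Sentence :=
  Formula.iExs (Fin m) (injF L2 m (α := Empty ⊕ Fin m) Sum.inr ⊓
    Formula.iAlls (Fin 4) ((grF L2 τ (α := (Empty ⊕ Fin m) ⊕ Fin 4)
      (fun i => Sum.inl (Sum.inr i)) (Sum.inr 0) (Sum.inr 1)).imp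
      ((grF L2 τ (α := (Empty ⊕ Fin m) ⊕ Fin 4)
      (fun i => Sum.inl (Sum.inr i)) (Sum.inr 2) (Sum.inr 3)).imp
      ((Relations.formula₂ (L := L2) TwoOrderRel.ltP
          (Term.var (Sum.inr 0)) (Term.var (Sum.inr 2))).imp
        (Relations.formula₂ (L := L2) TwoOrderRel.ltV
          (Term.var (Sum.inr 1)) (Term.var (Sum.inr 3)))))))

theorem sent1_sat {m n : ℕ} (τ : Equiv.Perm (Fin m)) (σ : Equiv.Perm (Fin n)) :
    Sat1 σ (sent1 τ) ↔ ∃ k, fullCycleType σ = fullCycleType τ + Multiset.replicate k 1 := by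
  rw [← gr_comb]
  letI := permStruc1 σ
  unfold Sat1 sent1 Sentence.Realize
  rw [Formula.realize_iExs]
  refine exists_congr fun x => ?_
  rw [Formula.realize_inf, injF_realize, Formula.realize_iAlls]
  refine and_congr Iff.rfl ?_
  simp only [Formula.realize_imp, grF_realize, Formula.realize_rel₂, Term.realize_var,
    Sum.elim_inl, Sum.elim_inr]
  constructor
  · intro h y z hyz
    exact h ![y, z] hyz
  · intro h i hi
    exact h _ _ hi

theorem sent2_sat {m n : ℕ} (τ : Equiv.Perm (Fin m)) (σ : Equiv.Perm (Fin n)) :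
    Sat2 σ (sent2 τ) ↔ ∃ k, fullCycleType σ = fullCycleType τ + Multiset.replicate k 1 := by
  rw [← gr_comb]
  letI := permStruc2 σ
  unfold Sat2 sent2 Sentence.Realize
  rw [Formula.realize_iExs]
  refine exists_congr fun x => ?_
  rw [Formula.realize_inf, injF_realize, Formula.realize_iAlls]
  refine and_congr_right fun hx => ?_
  rw [← gr_mono σ τ x hx]
  simp only [Formula.realize_imp, grF_realize, Formula.realize_rel₂, Term.realize_var,
    Sum.elim_inl, Sum.elim_inr]
  constructor
  · intro h y z y' z' h1 h2 h3
    exact h ![y, z, y', z'] h1 h2 h3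
  · intro h i h1 h2 h3
    exact h _ _ _ _ h1 h2 h3

theorem cardGe1 {n : ℕ} (σ : Equiv.Perm (Fin n)) (k : ℕ) :
    Sat1 σ (Sentence.cardGe L1 k) ↔ k ≤ n := by
  letI := permStruc1 σ
  unfold Sat1
  rw [Sentence.realize_cardGe]
  simp

theorem cardGe2 {n : ℕ} (σ : Equiv.Perm (Fin n)) (k : ℕ) :
    Sat2 σ (Sentence.cardGe L2 k) ↔ k ≤ n := by
  letI := permStruc2 σ
  unfold Sat2
  rw [Sentence.realize_cardGe]
  simp

theorem def_compl {s : Set Perms} (h : TOTODef s ∧ TOOBDef s) : TOTODef sᶜ ∧ TOOBDef sᶜ := by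
  obtain ⟨⟨φ, h2⟩, ⟨ψ, h1⟩⟩ := h
  refine ⟨⟨Formula.not φ, fun n σ => ?_⟩, ⟨Formula.not ψ, fun n σ => ?_⟩⟩
  · letI := permStruc2 σ
    exact Iff.trans Formula.realize_not (not_congr (h2 n σ))
  · letI := permStruc1 σ
    exact Iff.trans Formula.realize_not (not_congr (h1 n σ))

theorem def_inter {s t : Set Perms} (h : TOTODef s ∧ TOOBDef s) (h' : TOTODef t ∧ TOOBDef t) :
    TOTODef (s ∩ t) ∧ TOOBDef (s ∩ t) := by
  obtain ⟨⟨φ, h2⟩, ⟨ψ, h1⟩⟩ := h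
  obtain ⟨⟨φ', h2'⟩, ⟨ψ', h1'⟩⟩ := h'
  refine ⟨⟨φ ⊓ φ', fun n σ => ?_⟩, ⟨ψ ⊓ ψ', fun n σ => ?_⟩⟩
  · letI := permStruc2 σ
    exact Iff.trans Formula.realize_inf (and_congr (h2 n σ) (h2' n σ))
  · letI := permStruc1 σ
    exact Iff.trans Formula.realize_inf (and_congr (h1 n σ) (h1' n σ))

theorem def_base_D (lam : Multiset ℕ) (hlam : ∀ i ∈ lam, 0 < i) :
    TOTODef {p : Perms | ∃ k : ℕ, fullCycleType p.2 = lam + Multiset.replicate k 1} ∧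
    TOOBDef {p : Perms | ∃ k : ℕ, fullCycleType p.2 = lam + Multiset.replicate k 1} := by
  obtain ⟨τ, hτ⟩ := fct_exists lam hlam
  subst_vars
  refine ⟨⟨sent2 τ, fun n σ => ?_⟩, ⟨sent1 τ, fun n σ => ?_⟩⟩
  · rw [sent2_sat, hτ]; rfl
  · rw [sent1_sat, hτ]; rfl

theorem def_card (k : ℕ) : TOTODef {p : Perms | k ≤ p.1} ∧ TOOBDef {p : Perms | k ≤ p.1} :=
  ⟨⟨_, fun _ σ => cardGe2 σ k⟩, ⟨_, fun _ σ => cardGe1 σ k⟩⟩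

theorem backward (E : Set Perms) (h : CycleBool E) : TOTODef E ∧ TOOBDef E := by
  induction h with
  | base_C lam hlam =>
    have := def_inter (def_base_D lam hlam) (def_compl (def_card (lam.sum + 1)))
    convert this using 2 <;>
    · ext p
      simp only [Set.mem_inter_iff, Set.mem_compl_iff, Set.mem_setOf_eq]
      constructor
      · intro h
        refine ⟨⟨0, by simpa using h⟩, ?_⟩
        rw [← h, fct_sum]; omega
      · rintro ⟨⟨k, hk⟩, h⟩
        have h3 := congrArg Multiset.sum hk
        rw [fct_sum, Multiset.sum_add, Multiset.sum_replicate, smul_eq_mul, mul_one] at h3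
        have : k = 0 := by omega
        subst this
        simpa using hk
  | base_D lam hlam => exact def_base_D lam hlam
  | compl _ ih => exact def_compl ih
  | @union s t _ _ ih1 ih2 =>
    have := def_compl (def_inter (def_compl ih1) (def_compl ih2))
    rwa [← Set.compl_union, compl_compl] at this
  | inter _ _ ih1 ih2 => exact def_inter ih1 ih2

end formulas

theorem TOTO_and_TOOB_definable_iff_cycleBool (E : Set Perms) :
    (TOTODef E ∧ TOOBDef E) ↔ CycleBool E :=
  ⟨fun h => forward E h.1 h.2, backward E⟩
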